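/- arXiv:2605.01332 — 2 statements merged into one kernel-verified Lean document; each statement's English description precedes it below -/
import Mathlib

section
/- Let (W, S) be a Coxeter system, S_P ⊆ S a subset, and let w ∈ W^P be a Coxeter-type element with fixed reduced expression w = s_{i_1} ⋯ s_{i_r} having pairwise distinct simple reflections. Let F = {A ⊆ {1,…,r} : w_A ∈ W^P}. Then the map A ↦ w_A restricts to an order isomorphism from (F, ⊆) onto the interval [e,w]_{W^P} = {v ∈ W^P : v ≤ w} equipped with the Bruhat order. -/
/-- The Bruhat order on a Coxeter group, characterized by the subword property:
`u ≤ w` iff every reduced word for `w` contains a subword that is a reduced word for `u`. -/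
def CoxeterSystem.bruhatLE {B W : Type*} [Group W] {M : CoxeterMatrix B}
    (cs : CoxeterSystem M W) (u w : W) : Prop :=
  ∀ ω : List B, cs.IsReduced ω → cs.wordProd ω = w →
    ∃ ω' : List B, ω'.Sublist ω ∧ cs.IsReduced ω' ∧ cs.wordProd ω' = u

/-- Given a word `ω` and a set `A` of positions, the product of the letters of `ω`
at the positions in `A`, taken in increasing order. -/
def CoxeterSystem.subwordProd {B W : Type*} [Group W] {M : CoxeterMatrix B}
    (cs : CoxeterSystem M W) (ω : List B) (A : Finset (Fin ω.length)) : W :=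
  cs.wordProd ((A.sort (· ≤ ·)).map ω.get)

/-- The set `W^P` of minimal length coset representatives attached to a subset `S_P` of the
simple reflections: `W^P = {v ∈ W : ℓ(v s) > ℓ(v) for every s ∈ S_P}`. -/
def CoxeterSystem.minCosetReps {B W : Type*} [Group W] {M : CoxeterMatrix B}
    (cs : CoxeterSystem M W) (SP : Set B) : Set W :=
  {v | ∀ i ∈ SP, cs.length v < cs.length (v * cs.simple i)}

namespace CoxeterSystem

variable {B W : Type*} [Group W] {M : CoxeterMatrix B} (cs : CoxeterSystem M W)

open scoped Classical in
/-- A simple reflection acting on `W × ZMod 2` by conjugation on the first factor, flipping the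
sign at the reflection itself. -/
noncomputable def signedConjSimple (i : B) : Equiv.Perm (W × ZMod 2) :=
  Function.Involutive.toPerm
    (fun p ↦ (cs.simple i * p.1 * cs.simple i, p.2 + if p.1 = cs.simple i then 1 else 0)) <| by
    rintro ⟨t, ε⟩
    have h : cs.simple i * t * cs.simple i = cs.simple i ↔ t = cs.simple i := by
      constructor
      · intro h
        have := congrArg (fun x ↦ cs.simple i * x * cs.simple i) h
        simpa [mul_assoc] using this
      · rintro rfl; simp
    ext
    · simp [mul_assoc]
    · by_cases ht : t = cs.simple i
      · simp [ht, add_assoc, CharTwo.add_self_eq_zero]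
      · simp [h, ht]

open scoped Classical in
theorem signedConjSimple_apply (i : B) (t : W) (ε : ZMod 2) :
    cs.signedConjSimple i (t, ε) =
      (cs.simple i * t * cs.simple i, ε + if t = cs.simple i then 1 else 0) := rfl

open scoped Classical in
theorem signedConjSimple_mul_pow_apply (i j : B) (k : ℕ) (t : W) (ε : ZMod 2) :
    ((cs.signedConjSimple i * cs.signedConjSimple j) ^ k) (t, ε) =
      ((cs.simple i * cs.simple j) ^ k * t * ((cs.simple i * cs.simple j) ^ k)⁻¹,
        ε + ∑ l ∈ Finset.range (2 * k),
          if t = cs.simple j * (cs.simple i * cs.simple j) ^ l then 1 else 0) := by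
  induction k with
  | zero => simp
  | succ k ih =>
    have hx : ∀ n, cs.simple j * (cs.simple i * cs.simple j) ^ n =
        ((cs.simple i * cs.simple j) ^ n)⁻¹ * cs.simple j := by
      intro n
      induction n with
      | zero => simp
      | succ n ihn =>
        rw [pow_succ, ← mul_assoc, ihn, ← pow_succ, pow_succ']
        simp [mul_assoc]
    have h1 : (cs.simple i * cs.simple j) ^ k * t * ((cs.simple i * cs.simple j) ^ k)⁻¹ =
        cs.simple j ↔ t = cs.simple j * (cs.simple i * cs.simple j) ^ (2 * k) := by
      rw [two_mul, pow_add, ← mul_assoc, hx, mul_inv_eq_iff_eq_mul, ← eq_inv_mul_iff_mul_eq,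
        mul_assoc]
    have h2 : cs.simple j * ((cs.simple i * cs.simple j) ^ k * t *
          ((cs.simple i * cs.simple j) ^ k)⁻¹) * cs.simple j = cs.simple i ↔
        t = cs.simple j * (cs.simple i * cs.simple j) ^ (2 * k + 1) := by
      have he : cs.simple j * (cs.simple i * cs.simple j) ^ (2 * k + 1) =
          ((cs.simple i * cs.simple j) ^ k)⁻¹ * (cs.simple j * cs.simple i * cs.simple j) *
            (cs.simple i * cs.simple j) ^ k := by
        rw [show 2 * k + 1 = k + (1 + k) by ring, pow_add, ← mul_assoc, hx, pow_add, pow_one]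
        simp only [mul_assoc]
      rw [he]
      generalize (cs.simple i * cs.simple j) ^ k = y
      constructor
      · intro h
        rw [← h]
        simp [mul_assoc]
      · rintro rfl
        simp [mul_assoc]
    rw [pow_succ', Equiv.Perm.mul_apply, ih, Equiv.Perm.mul_apply, signedConjSimple_apply,
      signedConjSimple_apply, if_congr h1 rfl rfl, if_congr h2 rfl rfl, mul_add, mul_one,
      Finset.sum_range_succ, Finset.sum_range_succ]
    ext
    · simp [pow_succ', mul_assoc]
    · simp [add_assoc]

theorem isLiftable_signedConjSimple : M.IsLiftable cs.signedConjSimple := by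
  classical
  intro i j
  ext1 ⟨t, ε⟩
  rw [signedConjSimple_mul_pow_apply, two_mul, Finset.sum_range_add]
  simp [pow_add, CharTwo.add_self_eq_zero]

/-- The action of `W` on `W × ZMod 2` extending `signedConjSimple`; its second component detects
inversions. -/
noncomputable def signedConj : W →* Equiv.Perm (W × ZMod 2) :=
  cs.lift ⟨cs.signedConjSimple, cs.isLiftable_signedConjSimple⟩

theorem signedConj_simple (i : B) : cs.signedConj (cs.simple i) = cs.signedConjSimple i :=
  cs.lift_apply_simple cs.isLiftable_signedConjSimple i

open scoped Classical in
theorem signedConj_wordProd_apply (ω : List B) (t : W) (ε : ZMod 2) :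
    cs.signedConj (cs.wordProd ω) (t, ε) =
      (cs.wordProd ω * t * (cs.wordProd ω)⁻¹, ε + (cs.rightInvSeq ω).count t) := by
  induction ω with
  | nil => simp
  | cons i ω ih =>
    have h : cs.wordProd ω * t * (cs.wordProd ω)⁻¹ = cs.simple i ↔
        (cs.wordProd ω)⁻¹ * cs.simple i * cs.wordProd ω = t := by
      rw [mul_inv_eq_iff_eq_mul, ← eq_inv_mul_iff_mul_eq, ← mul_assoc, eq_comm]
    rw [cs.wordProd_cons, map_mul, Equiv.Perm.mul_apply, ih, signedConj_simple,
      signedConjSimple_apply, if_congr h rfl rfl]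
    ext
    · simp [mul_assoc]
    · simp [rightInvSeq, List.count_cons, add_assoc]

theorem signedConj_fst (w t : W) (ε : ZMod 2) :
    (cs.signedConj w (t, ε)).1 = w * t * w⁻¹ := by
  classical
  obtain ⟨ω, rfl⟩ := cs.wordProd_surjective w
  rw [signedConj_wordProd_apply]

theorem signedConj_snd (w t : W) (ε : ZMod 2) :
    (cs.signedConj w (t, ε)).2 = ε + (cs.signedConj w (t, 0)).2 := by
  classical
  obtain ⟨ω, rfl⟩ := cs.wordProd_surjective w
  simp [signedConj_wordProd_apply]

theorem mem_rightInvSeq_of_signedConj_ne {ω : List B} {t : W}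
    (h : (cs.signedConj (cs.wordProd ω) (t, 0)).2 ≠ 0) : t ∈ cs.rightInvSeq ω := by
  classical
  by_contra ht
  simp [signedConj_wordProd_apply, List.count_eq_zero_of_not_mem ht] at h

theorem IsReflection.signedConj_self {cs : CoxeterSystem M W} {t : W} (ht : cs.IsReflection t)
    (ε : ZMod 2) : cs.signedConj t (t, ε) = (t, ε + 1) := by
  obtain ⟨u, i, rfl⟩ := ht
  have h : cs.signedConj u⁻¹ (u * cs.simple i * u⁻¹, ε) =
      (cs.simple i, (cs.signedConj u⁻¹ (u * cs.simple i * u⁻¹, ε)).2) := by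
    ext
    · rw [signedConj_fst]
      simp [mul_assoc]
    · rfl
  have h' : cs.signedConj u (cs.simple i, (cs.signedConj u⁻¹ (u * cs.simple i * u⁻¹, ε)).2) =
      (u * cs.simple i * u⁻¹, ε) := by
    rw [← h, ← Equiv.Perm.mul_apply, ← map_mul]; simp
  rw [map_mul, map_mul, Equiv.Perm.mul_apply, Equiv.Perm.mul_apply, h, signedConj_simple,
    signedConjSimple_apply, if_pos rfl]
  ext
  · simp [signedConj_fst]
  · have h2 := congrArg Prod.snd h'
    rw [signedConj_snd] at h2
    rw [signedConj_snd, cs.simple_mul_simple_self, one_mul, add_right_comm, h2]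

/-- The strong exchange property. -/
theorem mem_rightInvSeq_of_isRightInversion {ω : List B} {t : W}
    (h : cs.IsRightInversion (cs.wordProd ω) t) : t ∈ cs.rightInvSeq ω := by
  apply cs.mem_rightInvSeq_of_signedConj_ne
  intro h0
  obtain ⟨τ, hτ, hτw⟩ := cs.exists_isReduced (cs.wordProd ω * t)
  have ht : t ∈ cs.rightInvSeq τ := by
    apply cs.mem_rightInvSeq_of_signedConj_ne
    rw [← hτw, map_mul, Equiv.Perm.mul_apply, h.1.signedConj_self, signedConj_snd, h0]
    simp
  have := (cs.isRightInversion_of_mem_rightInvSeq hτ ht).2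
  rw [← hτw, mul_assoc, h.1.mul_self, mul_one] at this
  exact lt_asymm this h.2

theorem exists_eraseIdx_of_isRightInversion {ω : List B} {t : W}
    (h : cs.IsRightInversion (cs.wordProd ω) t) :
    ∃ j < ω.length, cs.wordProd ω * t = cs.wordProd (ω.eraseIdx j) := by
  obtain ⟨j, hj, rfl⟩ := List.mem_iff_getElem.1 (cs.mem_rightInvSeq_of_isRightInversion h)
  exact ⟨j, by simpa using hj, by
    rw [← cs.wordProd_mul_getD_rightInvSeq, List.getD_eq_getElem _ _ hj]⟩

/-- The deletion property. -/
theorem exists_isReduced_sublist (ω : List B) :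
    ∃ ω' : List B, ω'.Sublist ω ∧ cs.IsReduced ω' ∧ cs.wordProd ω' = cs.wordProd ω := by
  induction ω using List.reverseRecOn with
  | nil => exact ⟨[], by simp, by simp [IsReduced], rfl⟩
  | append_singleton ω i ih =>
    obtain ⟨τ, hτω, hτ, hprod⟩ := ih
    rcases cs.length_mul_simple (cs.wordProd τ) i with h | h
    · refine ⟨τ ++ [i], hτω.append (List.Sublist.refl _), ?_, ?_⟩
      · simp [IsReduced, cs.wordProd_append, h, hτ.eq]
      · simp [cs.wordProd_append, hprod]
    · obtain ⟨j, hj, hjw⟩ := cs.exists_eraseIdx_of_isRightInversion (ω := τ)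
        ⟨cs.isReflection_simple i, by omega⟩
      refine ⟨τ.eraseIdx j, ((List.eraseIdx_sublist _ _).trans hτω).trans
        (List.sublist_append_left _ _), ?_, ?_⟩
      · have := List.length_eraseIdx_add_one hj
        rw [IsReduced, ← hjw]
        rw [hτ.eq] at h
        omega
      · rw [← hjw, hprod, cs.wordProd_append, cs.wordProd_singleton]

theorem exists_mem_simple_eq_of_wordProd_eq {ω : List B} {i : B}
    (h : cs.wordProd ω = cs.simple i) : ∃ j ∈ ω, cs.simple j = cs.simple i := by
  obtain ⟨τ, hτω, hτ, hprod⟩ := cs.exists_isReduced_sublist ω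
  rw [IsReduced, hprod, h, cs.length_simple] at hτ
  obtain ⟨j, rfl⟩ := List.length_eq_one_iff.1 hτ.symm
  exact ⟨j, hτω.subset (by simp), by rw [← h, ← hprod, cs.wordProd_singleton]⟩

theorem exists_mem_simple_eq_of_isRightDescent {ω : List B} {i : B}
    (h : cs.IsRightDescent (cs.wordProd ω) i) : ∃ j ∈ ω, cs.simple j = cs.simple i := by
  obtain ⟨k, -, hk⟩ := cs.exists_eraseIdx_of_isRightInversion (ω := ω)
    ⟨cs.isReflection_simple i, h⟩
  obtain ⟨j, hj, hji⟩ := cs.exists_mem_simple_eq_of_wordProd_eq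
    (ω := ω.reverse ++ ω.eraseIdx k) (i := i) (by
      rw [cs.wordProd_append, ← hk, cs.wordProd_reverse, inv_mul_cancel_left])
  refine ⟨j, ?_, hji⟩
  rcases List.mem_append.1 hj with hj | hj
  · exact List.mem_reverse.1 hj
  · exact List.mem_of_mem_eraseIdx hj

/-- The letters of a reduced word occur in every word with the same product. -/
theorem IsReduced.exists_mem_simple_eq {cs : CoxeterSystem M W} {τ : List B}
    (hτ : cs.IsReduced τ) {σ : List B} (h : cs.wordProd τ = cs.wordProd σ) {i : B} (hi : i ∈ τ) :
    ∃ j ∈ σ, cs.simple j = cs.simple i := by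
  induction τ using List.reverseRecOn generalizing σ with
  | nil => simp at hi
  | append_singleton τ k ih =>
    have hτ' : cs.IsReduced τ := by simpa using hτ.take τ.length
    have hprod : cs.wordProd σ * cs.simple k = cs.wordProd τ := by
      rw [← h, cs.wordProd_append, cs.wordProd_singleton, cs.simple_mul_simple_cancel_right]
    have hdesc : cs.IsRightDescent (cs.wordProd σ) k := by
      rw [IsRightDescent, hprod, ← h, hτ.eq, hτ'.eq]; simp
    rcases List.mem_append.1 hi with hi | hi
    · obtain ⟨l, -, hl⟩ := cs.exists_eraseIdx_of_isRightInversion (ω := σ)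
        ⟨cs.isReflection_simple k, hdesc⟩
      obtain ⟨j, hj, hji⟩ := ih hτ' (hprod.symm.trans hl) hi
      exact ⟨j, List.mem_of_mem_eraseIdx hj, hji⟩
    · rw [List.mem_singleton.1 hi]
      exact cs.exists_mem_simple_eq_of_isRightDescent hdesc

/-- A word in pairwise distinct simple reflections is reduced. -/
theorem isReduced_of_nodup {ω : List B} (h : (ω.map cs.simple).Nodup) : cs.IsReduced ω := by
  induction ω using List.reverseRecOn with
  | nil => simp [IsReduced]
  | append_singleton ω i ih =>
    rw [List.map_append, List.nodup_append] at h
    rcases cs.length_mul_simple (cs.wordProd ω) i with hl | hl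
    · simp [IsReduced, cs.wordProd_append, hl, (ih h.1).eq]
    · obtain ⟨j, hj, hji⟩ := cs.exists_mem_simple_eq_of_isRightDescent (ω := ω) (i := i)
        (by rw [IsRightDescent]; omega)
      exact absurd hji (h.2.2 _ (List.mem_map_of_mem hj) _ (by simp))

/-- One step up in the Bruhat graph. -/
def BruhatStep (u w : W) : Prop := cs.IsRightInversion w (w⁻¹ * u)

theorem BruhatStep.exists_eraseIdx {cs : CoxeterSystem M W} {u : W} {ω : List B}
    (h : cs.BruhatStep u (cs.wordProd ω)) :
    ∃ j < ω.length, u = cs.wordProd (ω.eraseIdx j) := by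
  obtain ⟨j, hj, h⟩ := cs.exists_eraseIdx_of_isRightInversion h
  exact ⟨j, hj, by rw [← h, mul_inv_cancel_left]⟩

theorem exists_sublist_of_reflTransGen {u w : W} (h : Relation.ReflTransGen cs.BruhatStep u w) :
    ∀ ω : List B, cs.wordProd ω = w → ∃ ω' : List B, ω'.Sublist ω ∧ cs.wordProd ω' = u := by
  induction h with
  | refl => exact fun ω hω ↦ ⟨ω, List.Sublist.refl _, hω⟩
  | tail _ hstep ih =>
    rintro ω rfl
    obtain ⟨j, -, rfl⟩ := hstep.exists_eraseIdx
    obtain ⟨ω', hsub, hω'⟩ := ih _ rfl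
    exact ⟨ω', hsub.trans (List.eraseIdx_sublist _ _), hω'⟩

theorem bruhatLE_of_reflTransGen {u w : W} (h : Relation.ReflTransGen cs.BruhatStep u w) :
    cs.bruhatLE u w := by
  intro ω _ hω
  obtain ⟨σ, hσω, rfl⟩ := cs.exists_sublist_of_reflTransGen h ω hω
  obtain ⟨τ, hτσ, hτ, hprod⟩ := cs.exists_isReduced_sublist σ
  exact ⟨τ, hτσ.trans hσω, hτ, hprod⟩

theorem bruhatStep_simple_mul {w : W} {i : B} (h : cs.length w < cs.length (cs.simple i * w)) :
    cs.BruhatStep w (cs.simple i * w) := by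
  have he : (cs.simple i * w)⁻¹ * w = w⁻¹ * cs.simple i * w⁻¹⁻¹ := by simp [mul_assoc]
  refine ⟨⟨w⁻¹, i, he⟩, ?_⟩
  rwa [mul_inv_cancel_left]

theorem BruhatStep.simple_mul {cs : CoxeterSystem M W} {x y : W} (h : cs.BruhatStep x y) (i : B) :
    cs.simple i * x = y ∨ cs.BruhatStep (cs.simple i * x) (cs.simple i * y) := by
  have he : (cs.simple i * y)⁻¹ * (cs.simple i * x) = y⁻¹ * x := by simp [mul_assoc]
  have hlt : cs.length x < cs.length y := by simpa using h.2
  by_cases hl : cs.length (cs.simple i * x) < cs.length (cs.simple i * y)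
  · right
    refine ⟨he ▸ h.1, ?_⟩
    rwa [mul_inv_cancel_left]
  left
  have hne := h.1.length_mul_left_ne (cs.simple i * y)
  rw [← he, mul_inv_cancel_left] at hne
  have hx := cs.length_simple_mul x i
  have hy := cs.length_simple_mul y i
  obtain ⟨τ, hτ, hτy⟩ := cs.exists_isReduced (cs.simple i * y)
  have hyw : y = cs.wordProd (i :: τ) := by
    rw [cs.wordProd_cons, ← hτy, cs.simple_mul_simple_cancel_left]
  rw [hyw] at h
  obtain ⟨j, hj, hxj⟩ := h.exists_eraseIdx
  cases j with
  | zero => rw [hxj, hyw, cs.wordProd_cons]; rfl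
  | succ j =>
    rw [List.eraseIdx_cons_succ, cs.wordProd_cons] at hxj
    have h1 : cs.length (cs.simple i * x) ≤ (τ.eraseIdx j).length := by
      rw [hxj, cs.simple_mul_simple_cancel_left]
      exact cs.length_wordProd_le _
    have h2 := List.length_eraseIdx_add_one (l := τ) (i := j) (by simpa using hj)
    have h3 := hτ.eq
    rw [← hτy] at h3
    omega

theorem reflTransGen_simple_mul {x y : W} (h : Relation.ReflTransGen cs.BruhatStep x y) {i : B}
    (hy : cs.length y < cs.length (cs.simple i * y)) :
    Relation.ReflTransGen cs.BruhatStep (cs.simple i * x) (cs.simple i * y) := by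
  induction h using Relation.ReflTransGen.head_induction_on with
  | refl => exact .refl
  | head hstep hrest ih =>
    rcases hstep.simple_mul i with rfl | h
    · exact hrest.tail (cs.bruhatStep_simple_mul hy)
    · exact ih.head h

theorem IsReduced.reflTransGen_of_sublist {cs : CoxeterSystem M W} {ω σ : List B}
    (hω : cs.IsReduced ω) (h : σ.Sublist ω) :
    Relation.ReflTransGen cs.BruhatStep (cs.wordProd σ) (cs.wordProd ω) := by
  induction h with
  | slnil => exact .refl
  | @cons σ ω i _ ih =>
    have hω' : cs.IsReduced ω := by simpa using hω.drop 1
    rw [cs.wordProd_cons]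
    refine (ih hω').tail (cs.bruhatStep_simple_mul ?_)
    rw [← cs.wordProd_cons, hω.eq, hω'.eq]; simp
  | @cons_cons σ ω i _ ih =>
    have hω' : cs.IsReduced ω := by simpa using hω.drop 1
    rw [cs.wordProd_cons, cs.wordProd_cons]
    refine cs.reflTransGen_simple_mul (ih hω') ?_
    rw [← cs.wordProd_cons, hω.eq, hω'.eq]; simp

/-- The subword property: a subword of one reduced word for `w` lies below `w`. -/
theorem IsReduced.bruhatLE_of_sublist {cs : CoxeterSystem M W} {ω σ : List B}
    (hω : cs.IsReduced ω) (h : σ.Sublist ω) : cs.bruhatLE (cs.wordProd σ) (cs.wordProd ω) :=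
  cs.bruhatLE_of_reflTransGen (hω.reflTransGen_of_sublist h)

theorem sort_map_get_sublist_of_subset (ω : List B) {A A' : Finset (Fin ω.length)} (h : A ⊆ A') :
    ((A.sort (· ≤ ·)).map ω.get).Sublist ((A'.sort (· ≤ ·)).map ω.get) :=
  (List.sublist_of_subperm_of_pairwise
    ((A.sort_nodup _).subperm fun a ha ↦ by simpa using h (by simpa using ha))
    (A.pairwise_sort _) (A'.pairwise_sort _)).map _

theorem exists_subset_of_sublist_sort_map_get {ω τ : List B} {A : Finset (Fin ω.length)}
    (h : τ.Sublist ((A.sort (· ≤ ·)).map ω.get)) :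
    ∃ A' ⊆ A, (A'.sort (· ≤ ·)).map ω.get = τ := by
  obtain ⟨l, hl, rfl⟩ := List.sublist_map_iff.1 h
  refine ⟨l.toFinset, fun a ha ↦ by simpa using hl.subset (List.mem_toFinset.1 ha), ?_⟩
  rw [(List.toFinset_sort _ (hl.nodup (A.sort_nodup _))).2 ((A.pairwise_sort _).sublist hl)]

theorem sort_univ_map_get (ω : List B) :
    ((Finset.univ : Finset (Fin ω.length)).sort (· ≤ ·)).map ω.get = ω := by
  rw [Fin.sort_univ, List.map_get_finRange]

theorem isReduced_sort_map_get {ω : List B} (h : (ω.map cs.simple).Nodup)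
    (A : Finset (Fin ω.length)) : cs.IsReduced ((A.sort (· ≤ ·)).map ω.get) := by
  apply cs.isReduced_of_nodup
  have hsub := sort_map_get_sublist_of_subset ω (Finset.subset_univ A)
  rw [sort_univ_map_get] at hsub
  exact (hsub.map _).nodup h

theorem subset_of_subwordProd_eq {ω : List B} (h : (ω.map cs.simple).Nodup)
    {A A' : Finset (Fin ω.length)} (hA : cs.subwordProd ω A = cs.subwordProd ω A') : A ⊆ A' := by
  intro a ha
  obtain ⟨_, hj, hja⟩ := (cs.isReduced_sort_map_get h A).exists_mem_simple_eq hA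
    (List.mem_map_of_mem ((Finset.mem_sort _).2 ha))
  obtain ⟨b, hb, rfl⟩ := List.mem_map.1 hj
  have hba : b = a := by
    have := (h.getElem_inj_iff (i := b) (j := a) (hi := by simp) (hj := by simp)).1
      (by simpa using hja)
    exact Fin.ext this
  exact hba ▸ (Finset.mem_sort _).1 hb

theorem subwordProd_injective {ω : List B} (h : (ω.map cs.simple).Nodup) :
    Function.Injective (cs.subwordProd ω) := fun _ _ hA ↦
  (cs.subset_of_subwordProd_eq h hA).antisymm (cs.subset_of_subwordProd_eq h hA.symm)

/-- For a word in distinct simple reflections, containment of index sets is the Bruhat order. -/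
theorem subset_iff_bruhatLE_subwordProd {ω : List B} (h : (ω.map cs.simple).Nodup)
    (A A' : Finset (Fin ω.length)) :
    A ⊆ A' ↔ cs.bruhatLE (cs.subwordProd ω A) (cs.subwordProd ω A') := by
  constructor
  · intro hA
    exact (cs.isReduced_sort_map_get h A').bruhatLE_of_sublist (sort_map_get_sublist_of_subset ω hA)
  · intro hle
    obtain ⟨τ, hτ, -, hprod⟩ := hle _ (cs.isReduced_sort_map_get h A') rfl
    obtain ⟨A'', hA'', rfl⟩ := exists_subset_of_sublist_sort_map_get hτ
    rwa [← cs.subwordProd_injective h hprod]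

end CoxeterSystem

/-- Let `w ∈ W^P` be a Coxeter-type element with a fixed reduced expression
`w = s_{i_1} ⋯ s_{i_r}` having pairwise distinct simple reflections, and let
`F = {A ⊆ {1,…,r} : w_A ∈ W^P}`. Then `A ↦ w_A` restricts to an order isomorphism from
`(F, ⊆)` onto the Bruhat interval `[e, w]_{W^P} = {v ∈ W^P : v ≤ w}`. -/
theorem feasible_sets_orderIso_interval {B W : Type*} [Group W] {M : CoxeterMatrix B}
    (cs : CoxeterSystem M W) (SP : Set B) (w : W) (hw : w ∈ cs.minCosetReps SP)
    (ω : List B) (hred : cs.IsReduced ω) (hprod : cs.wordProd ω = w)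
    (hdist : (ω.map cs.simple).Nodup) :
    (∀ A : Finset (Fin ω.length), cs.subwordProd ω A ∈ cs.minCosetReps SP →
      cs.bruhatLE (cs.subwordProd ω A) w) ∧
    (∀ A A' : Finset (Fin ω.length), cs.subwordProd ω A ∈ cs.minCosetReps SP →
      cs.subwordProd ω A' ∈ cs.minCosetReps SP →
      (A ⊆ A' ↔ cs.bruhatLE (cs.subwordProd ω A) (cs.subwordProd ω A'))) ∧
    (∀ v : W, v ∈ cs.minCosetReps SP → cs.bruhatLE v w →
      ∃! A : Finset (Fin ω.length),
        cs.subwordProd ω A ∈ cs.minCosetReps SP ∧ cs.subwordProd ω A = v) := by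
  have huniv : cs.subwordProd ω Finset.univ = w := by
    rw [CoxeterSystem.subwordProd, CoxeterSystem.sort_univ_map_get, hprod]
  refine ⟨fun A _ ↦ ?_, fun A A' _ _ ↦ cs.subset_iff_bruhatLE_subwordProd hdist A A',
    fun v hv hvw ↦ ?_⟩
  · rw [← huniv]
    exact (cs.subset_iff_bruhatLE_subwordProd hdist _ _).1 (Finset.subset_univ A)
  · obtain ⟨τ, hτ, -, rfl⟩ := hvw ω hred hprod
    rw [← CoxeterSystem.sort_univ_map_get ω] at hτ
    obtain ⟨A, -, rfl⟩ := CoxeterSystem.exists_subset_of_sublist_sort_map_get hτ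
    exact ⟨A, ⟨hv, rfl⟩, fun A' hA' ↦ cs.subwordProd_injective hdist hA'.2⟩
end

section
/- Let (W, S) be a Coxeter system and let v ∈ W admit a reduced word in which the simple reflections are pairwise distinct. Then every reduced word for v is obtained from this one by a finite sequence of interchanges of adjacent commuting letters; in particular, every reduced word for v consists of the same pairwise distinct simple reflections, and no braid move of length at least 3 occurs between reduced words of v. -/
/-- One interchange of two adjacent commuting letters in a word. -/
def CoxeterSystem.CommSwap {B W : Type*} [Group W] {M : CoxeterMatrix B}
    (cs : CoxeterSystem M W) (x y : List B) : Prop :=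
  ∃ (l₁ l₂ : List B) (a b : B),
    x = l₁ ++ a :: b :: l₂ ∧ y = l₁ ++ b :: a :: l₂ ∧
    cs.simple a * cs.simple b = cs.simple b * cs.simple a

namespace CoxeterMatrix

variable {B : Type*} (M : CoxeterMatrix B)

/-- The space on which the Coxeter group acts: the first summand is spanned by the simple roots,
the second one by vectors dual to the simple coroots. -/
abbrev DoubledRootSpace (B : Type*) := (B →₀ ℂ) × (B →₀ ℂ)

/-- The number `2 cos (π / M i j)`, written with exponentials. It is `-2` for `i = j`. -/
noncomputable def cartanCoeff (i j : B) : ℂ :=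
  Complex.exp (Real.pi * Complex.I / M i j) + (Complex.exp (Real.pi * Complex.I / M i j))⁻¹

/-- The simple root attached to `i`. -/
noncomputable def simpleRoot (i : B) : DoubledRootSpace B := (Finsupp.single i 1, 0)

/-- The vector dual to the simple coroot attached to `i`. -/
noncomputable def coweight (i : B) : DoubledRootSpace B := (0, Finsupp.single i 1)

/-- The simple coroot attached to `i`. -/
noncomputable def simpleCoroot (i : B) : DoubledRootSpace B →ₗ[ℂ] ℂ :=
  (Finsupp.linearCombination ℂ (M.cartanCoeff i)).coprod (Finsupp.lapply i)

/-- The simple reflection attached to `i`; it maps the simple root to its negative. -/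
noncomputable def simpleReflection (i : B) : Module.End ℂ (DoubledRootSpace B) :=
  1 + (M.simpleCoroot i).smulRight (simpleRoot i)

theorem simpleReflection_apply (i : B) (x : DoubledRootSpace B) :
    M.simpleReflection i x = x + M.simpleCoroot i x • simpleRoot i := rfl

theorem simpleCoroot_simpleRoot (i j : B) :
    M.simpleCoroot i (simpleRoot j) = M.cartanCoeff i j := by
  simp [simpleCoroot, simpleRoot]

theorem simpleCoroot_coweight_self (i : B) : M.simpleCoroot i (coweight i) = 1 := by
  simp [simpleCoroot, coweight]

theorem simpleCoroot_coweight_of_ne {i j : B} (h : i ≠ j) :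
    M.simpleCoroot i (coweight j) = 0 := by
  simp [simpleCoroot, coweight, h.symm]

theorem cartanCoeff_self (i : B) : M.cartanCoeff i i = -2 := by
  simp [cartanCoeff, Complex.exp_pi_mul_I]
  norm_num

theorem cartanCoeff_comm (i j : B) : M.cartanCoeff i j = M.cartanCoeff j i := by
  rw [cartanCoeff, cartanCoeff, M.symmetric]

theorem exp_pi_mul_I_div_sq (m : ℕ) :
    Complex.exp (Real.pi * Complex.I / m) ^ 2 = Complex.exp (2 * Real.pi * Complex.I / m) := by
  rw [← Complex.exp_nat_mul]
  congr 1
  push_cast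
  ring

theorem cartanCoeff_sq (i j : B) :
    M.cartanCoeff i j ^ 2 = 2 + Complex.exp (2 * Real.pi * Complex.I / M i j) +
      (Complex.exp (2 * Real.pi * Complex.I / M i j))⁻¹ := by
  have h := Complex.exp_ne_zero (Real.pi * Complex.I / M i j)
  rw [← exp_pi_mul_I_div_sq, cartanCoeff]
  field_simp
  ring

theorem eq_two_of_cartanCoeff_eq_zero {i j : B} (hij : i ≠ j) (h : M.cartanCoeff i j = 0) :
    M i j = 2 := by
  have h0 : M i j ≠ 0 := by
    intro h0
    norm_num [cartanCoeff, h0] at h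
  have hζ := Complex.isPrimitiveRoot_exp _ h0
  have hne := Complex.exp_ne_zero (2 * Real.pi * Complex.I / M i j)
  have hsq := M.cartanCoeff_sq i j
  rw [h] at hsq
  set ζ := Complex.exp (2 * Real.pi * Complex.I / M i j)
  have hζ1 : (ζ + 1) ^ 2 = 0 := by
    field_simp at hsq
    linear_combination -hsq
  have hζ2 : ζ = -1 := eq_neg_of_add_eq_zero_left (pow_eq_zero_iff two_ne_zero |>.1 hζ1)
  have hdvd : M i j ∣ 2 := hζ.dvd_of_pow_eq_one 2 (by rw [hζ2]; norm_num)
  exact ((Nat.dvd_prime Nat.prime_two).1 hdvd).resolve_left (M.off_diagonal i j hij)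

theorem cartanCoeff_eq_zero_of_eq_two {i j : B} (h : M i j = 2) : M.cartanCoeff i j = 0 := by
  have h2 : Real.pi * Complex.I / 2 = Real.pi / 2 * Complex.I := by ring
  simp [cartanCoeff, h, h2, Complex.exp_pi_div_two_mul_I]

theorem simpleReflection_mul_self (i : B) : M.simpleReflection i * M.simpleReflection i = 1 := by
  refine LinearMap.ext fun x => ?_
  simp only [Module.End.mul_apply, Module.End.one_apply, simpleReflection_apply, map_add, map_smul,
    simpleCoroot_simpleRoot, cartanCoeff_self]
  module

open Polynomial in
theorem cubic_dvd_X_pow_sub_one {m : ℕ} (hm : 3 ≤ m) {ζ : ℂ} (hζ : IsPrimitiveRoot ζ m) :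
    (X - C 1) * ((X - C ζ) * (X - C ζ⁻¹)) ∣ (X ^ m - 1 : ℂ[X]) := by
  have h0 : ζ ≠ 0 := hζ.ne_zero (by omega)
  have h1 : ζ ≠ 1 := hζ.ne_one (by omega)
  have h2 : ζ ≠ ζ⁻¹ := by
    intro h
    refine hζ.pow_ne_one_of_pos_of_lt (l := 2) (by omega) (by omega) ?_
    rw [pow_two]
    nth_rewrite 1 [h]
    exact inv_mul_cancel₀ h0
  have coprime {x y : ℂ} (h : x ≠ y) : IsCoprime (X - C x) (X - C y) :=
    isCoprime_X_sub_C_of_isUnit_sub (sub_ne_zero.2 h).isUnit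
  have dvd {x : ℂ} (hx : x ^ m = 1) : X - C x ∣ (X ^ m - 1 : ℂ[X]) := by
    rw [dvd_iff_isRoot]
    simp [hx]
  refine IsCoprime.mul_dvd (IsCoprime.mul_right (coprime h1.symm) (coprime ?_)) (dvd (one_pow m))
    (IsCoprime.mul_dvd (coprime h2) (dvd hζ.pow_eq_one) (dvd ?_))
  · exact fun h => h1 (inv_eq_one.1 h.symm)
  · rw [inv_pow, hζ.pow_eq_one, inv_one]

theorem simpleReflection_mul_cubic (i j : B) {R : Module.End ℂ (DoubledRootSpace B)}
    (hR : R = M.simpleReflection i * M.simpleReflection j) :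
    R ^ 3 - (M.cartanCoeff i j ^ 2 - 1) • R ^ 2 + (M.cartanCoeff i j ^ 2 - 1) • R - 1 = 0 := by
  have hR' (x) : R x = x + (M.simpleCoroot i x + M.cartanCoeff i j * M.simpleCoroot j x) •
      simpleRoot i + M.simpleCoroot j x • simpleRoot j := by
    simp only [hR, Module.End.mul_apply, simpleReflection_apply, map_add, map_smul,
      simpleCoroot_simpleRoot]
    module
  have hi : R (simpleRoot i) = (M.cartanCoeff i j ^ 2 - 1) • simpleRoot i +
      M.cartanCoeff i j • simpleRoot j := by
    rw [hR', simpleCoroot_simpleRoot, simpleCoroot_simpleRoot, cartanCoeff_self,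
      M.cartanCoeff_comm j i]
    module
  have hj : R (simpleRoot j) = -M.cartanCoeff i j • simpleRoot i - simpleRoot j := by
    rw [hR', simpleCoroot_simpleRoot, simpleCoroot_simpleRoot, cartanCoeff_self]
    module
  refine LinearMap.ext fun x => ?_
  simp only [LinearMap.sub_apply, LinearMap.add_apply, LinearMap.smul_apply, pow_succ (n := 2),
    pow_two R, Module.End.mul_apply, Module.End.one_apply, LinearMap.zero_apply]
  rw [hR' x]
  simp only [map_add, map_sub, map_smul, hi, hj, hR' x]
  module

open Polynomial in
theorem isLiftable_simpleReflection : M.IsLiftable M.simpleReflection := by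
  intro i j
  rcases eq_or_ne i j with rfl | hij
  · rw [simpleReflection_mul_self, one_pow]
  rcases Nat.lt_or_ge (M i j) 3 with hm | hm
  · have h1 := M.off_diagonal i j hij
    obtain h | h : M i j = 0 ∨ M i j = 2 := by omega
    · rw [h, pow_zero]
    · have h0 := M.cartanCoeff_eq_zero_of_eq_two h
      have hcomm : M.simpleReflection i * M.simpleReflection j =
          M.simpleReflection j * M.simpleReflection i := by
        refine LinearMap.ext fun x => ?_
        simp only [Module.End.mul_apply, simpleReflection_apply, map_add, map_smul,
          simpleCoroot_simpleRoot, M.cartanCoeff_comm j i, h0]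
        module
      rw [h, pow_two]
      nth_rewrite 2 [hcomm]
      rw [mul_assoc, ← mul_assoc _ _ (M.simpleReflection i), simpleReflection_mul_self, one_mul,
        simpleReflection_mul_self]
  · obtain ⟨q, hq⟩ := cubic_dvd_X_pow_sub_one hm (Complex.isPrimitiveRoot_exp (M i j) (by omega))
    have hcub := M.simpleReflection_mul_cubic i j rfl
    have hsq := M.cartanCoeff_sq i j
    have hne := Complex.exp_ne_zero (2 * Real.pi * Complex.I / M i j)
    set ζ := Complex.exp (2 * Real.pi * Complex.I / M i j)
    have hpoly : (X - C 1) * ((X - C ζ) * (X - C ζ⁻¹)) =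
        X ^ 3 - (M.cartanCoeff i j ^ 2 - 1) • X ^ 2 + (M.cartanCoeff i j ^ 2 - 1) • X - 1 := by
      have hC : C ζ * C ζ⁻¹ = 1 := by rw [← C_mul, mul_inv_cancel₀ hne, C_1]
      simp only [hsq, smul_eq_C_mul, C_sub, C_add, C_1, C_ofNat]
      linear_combination (X - 1) * hC
    have h := congrArg (aeval (M.simpleReflection i * M.simpleReflection j)) hq
    rw [hpoly, map_mul] at h
    simp only [map_sub, map_add, map_smul, map_pow, aeval_X, map_one, hcub, zero_mul] at h
    exact sub_eq_zero.1 h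

end CoxeterMatrix

namespace CoxeterSystem

open CoxeterMatrix

variable {B W : Type*} [Group W] {M : CoxeterMatrix B} (cs : CoxeterSystem M W)

/-- The linear representation of `W` in which simple generators act by simple reflections. -/
noncomputable def reflectionRep : W →* Module.End ℂ (DoubledRootSpace B) :=
  cs.lift ⟨M.simpleReflection, M.isLiftable_simpleReflection⟩

theorem reflectionRep_wordProd_cons (i : B) (ω : List B) (x : DoubledRootSpace B) :
    cs.reflectionRep (cs.wordProd (i :: ω)) x =
      M.simpleReflection i (cs.reflectionRep (cs.wordProd ω) x) := by
  rw [wordProd_cons, map_mul, Module.End.mul_apply, reflectionRep,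
    cs.lift_apply_simple M.isLiftable_simpleReflection]

theorem reflectionRep_wordProd_fst_of_notMem {c : B} {ω : List B} (h : c ∉ ω)
    (x : DoubledRootSpace B) : (cs.reflectionRep (cs.wordProd ω) x).1 c = x.1 c := by
  induction ω with
  | nil => simp
  | cons i ω ih =>
    rw [List.mem_cons, not_or] at h
    rw [reflectionRep_wordProd_cons, simpleReflection_apply]
    simp [ih h.2, simpleRoot, Ne.symm h.1]

theorem reflectionRep_wordProd_coweight_of_notMem {c : B} {ω : List B} (h : c ∉ ω) :
    cs.reflectionRep (cs.wordProd ω) (coweight c) = coweight c := by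
  induction ω with
  | nil => simp
  | cons i ω ih =>
    rw [List.mem_cons, not_or] at h
    rw [reflectionRep_wordProd_cons, ih h.2, simpleReflection_apply,
      M.simpleCoroot_coweight_of_ne (Ne.symm h.1), zero_smul, add_zero]

theorem reflectionRep_wordProd_append_cons_coweight {c : B} (u : List B) {w : List B}
    (hw : c ∉ w) (hu : c ∉ u) :
    cs.reflectionRep (cs.wordProd (u ++ c :: w)) (coweight c) =
      coweight c + cs.reflectionRep (cs.wordProd u) (simpleRoot c) := by
  rw [wordProd_append, map_mul, Module.End.mul_apply, reflectionRep_wordProd_cons,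
    cs.reflectionRep_wordProd_coweight_of_notMem hw, simpleReflection_apply,
    simpleCoroot_coweight_self, one_smul, map_add,
    cs.reflectionRep_wordProd_coweight_of_notMem hu]

/-- A letter occurring exactly once in some word for `v` occurs in every word for `v`. -/
theorem mem_of_wordProd_append_cons_eq {c : B} {u w ω : List B} (hu : c ∉ u) (hw : c ∉ w)
    (h : cs.wordProd (u ++ c :: w) = cs.wordProd ω) : c ∈ ω := by
  by_contra hc
  have key := cs.reflectionRep_wordProd_append_cons_coweight u hw hu
  rw [h, cs.reflectionRep_wordProd_coweight_of_notMem hc, left_eq_add] at key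
  have := cs.reflectionRep_wordProd_fst_of_notMem hu (simpleRoot c)
  rw [key] at this
  simp [simpleRoot] at this

theorem perm_of_nodup_of_wordProd_eq {ω ω' : List B} (hω : ω.Nodup)
    (hlen : ω'.length ≤ ω.length) (h : cs.wordProd ω = cs.wordProd ω') : ω.Perm ω' := by
  refine (hω.subperm fun c hc => ?_).perm_of_length_le hlen
  obtain ⟨u, w, rfl⟩ := List.append_of_mem hc
  rw [List.nodup_middle, List.nodup_cons, List.mem_append, not_or] at hω
  exact cs.mem_of_wordProd_append_cons_eq hω.1.1 hω.1.2 h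

theorem simple_mul_simple_comm_of_eq_two {i j : B} (h : M i j = 2) :
    cs.simple i * cs.simple j = cs.simple j * cs.simple i := by
  have := cs.simple_mul_simple_pow i j
  rw [h, pow_two] at this
  simpa using eq_inv_of_mul_eq_one_left this

theorem simple_comm_of_reflectionRep_simpleRoot_eq {c : B} {u : List B} (hu : u.Nodup)
    (hc : c ∉ u) (h : cs.reflectionRep (cs.wordProd u) (simpleRoot c) = simpleRoot c) :
    ∀ i ∈ u, cs.simple i * cs.simple c = cs.simple c * cs.simple i := by
  induction u with
  | nil => simp
  | cons i u ih =>
    rw [List.mem_cons, not_or] at hc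
    rw [List.nodup_cons] at hu
    rw [reflectionRep_wordProd_cons, simpleReflection_apply] at h
    have hcoord := congrArg (fun x : DoubledRootSpace B => x.1 i) h
    have hfix := cs.reflectionRep_wordProd_fst_of_notMem hu.1 (simpleRoot c)
    have h0 : M.simpleCoroot i (cs.reflectionRep (cs.wordProd u) (simpleRoot c)) = 0 := by
      simp only [Prod.fst_add, Prod.smul_fst, Finsupp.add_apply, Finsupp.smul_apply, hfix,
        add_eq_left] at hcoord
      simpa only [simpleRoot, Finsupp.single_eq_same, smul_eq_mul, mul_one] using hcoord
    rw [h0, zero_smul, add_zero] at h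
    rw [h, simpleCoroot_simpleRoot] at h0
    rw [List.forall_mem_cons]
    exact ⟨cs.simple_mul_simple_comm_of_eq_two
      (M.eq_two_of_cartanCoeff_eq_zero (Ne.symm hc.1) h0), ih hu.2 hc.2 h⟩

theorem CommSwap.cons {cs : CoxeterSystem M W} {x y : List B} (h : cs.CommSwap x y) (c : B) :
    cs.CommSwap (c :: x) (c :: y) := by
  obtain ⟨l₁, l₂, a, b, rfl, rfl, hab⟩ := h
  exact ⟨c :: l₁, l₂, a, b, rfl, rfl, hab⟩

theorem reflTransGen_commSwap_cons {x y : List B} (h : Relation.ReflTransGen cs.CommSwap x y)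
    (c : B) : Relation.ReflTransGen cs.CommSwap (c :: x) (c :: y) :=
  h.lift (c :: ·) fun _ _ hxy => hxy.cons c

theorem reflTransGen_commSwap_append_cons {c : B} {u : List B} (w : List B)
    (h : ∀ i ∈ u, cs.simple i * cs.simple c = cs.simple c * cs.simple i) :
    Relation.ReflTransGen cs.CommSwap (u ++ c :: w) (c :: (u ++ w)) := by
  induction u with
  | nil => exact .refl
  | cons i u ih =>
    rw [List.forall_mem_cons] at h
    exact (cs.reflTransGen_commSwap_cons (ih h.2) i).tail ⟨[], u ++ w, i, c, rfl, rfl, h.1⟩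

theorem CommSwap.wordProd_eq {cs : CoxeterSystem M W} {x y : List B} (h : cs.CommSwap x y) :
    cs.wordProd x = cs.wordProd y := by
  obtain ⟨l₁, l₂, a, b, rfl, rfl, hab⟩ := h
  simp only [wordProd_append, wordProd_cons, ← mul_assoc (cs.simple _), hab]

theorem wordProd_eq_of_reflTransGen_commSwap {x y : List B}
    (h : Relation.ReflTransGen cs.CommSwap x y) : cs.wordProd x = cs.wordProd y := by
  induction h with
  | refl => rfl
  | tail _ hyz ih => exact ih.trans hyz.wordProd_eq

theorem reflTransGen_commSwap_of_nodup {ω ω' : List B} (hω : ω.Nodup)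
    (hlen : ω'.length ≤ ω.length) (h : cs.wordProd ω = cs.wordProd ω') :
    Relation.ReflTransGen cs.CommSwap ω ω' := by
  induction ω' generalizing ω with
  | nil => rw [(cs.perm_of_nodup_of_wordProd_eq hω hlen h).eq_nil]
  | cons c ω' ih =>
    have hperm := cs.perm_of_nodup_of_wordProd_eq hω hlen h
    have hc' : c ∉ ω' := (List.nodup_cons.1 (hperm.nodup_iff.1 hω)).1
    obtain ⟨u, w, rfl⟩ := List.append_of_mem (hperm.mem_iff.2 List.mem_cons_self)
    rw [List.nodup_middle, List.nodup_cons, List.mem_append, not_or] at hω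
    obtain ⟨⟨hcu, hcw⟩, huw⟩ := hω
    have hfix : cs.reflectionRep (cs.wordProd u) (simpleRoot c) = simpleRoot c := by
      have h1 := cs.reflectionRep_wordProd_append_cons_coweight u hcw hcu
      have h2 := cs.reflectionRep_wordProd_append_cons_coweight [] hc' List.not_mem_nil
      rw [List.nil_append, ← h, h1] at h2
      simpa using h2
    have hmove := cs.reflTransGen_commSwap_append_cons w
      (cs.simple_comm_of_reflectionRep_simpleRoot_eq huw.of_append_left hcu hfix)
    have hprod := (cs.wordProd_eq_of_reflTransGen_commSwap hmove).symm.trans h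
    rw [wordProd_cons, wordProd_cons, mul_right_inj] at hprod
    refine hmove.trans (cs.reflTransGen_commSwap_cons (ih huw ?_ hprod) c)
    simp only [List.length_append, List.length_cons] at hlen ⊢
    omega

end CoxeterSystem

/-- Let `v ∈ W` admit a reduced word `ω` in which the simple reflections are
pairwise distinct. Then every reduced word for `v` is obtained from `ω` by a finite sequence
of interchanges of adjacent commuting letters; in particular, every reduced word for `v`
consists of the same pairwise distinct simple reflections. -/
theorem reduced_words_connected_by_comm_swaps {B W : Type*} [Group W] {M : CoxeterMatrix B}
    (cs : CoxeterSystem M W) (v : W) (ω : List B)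
    (hred : cs.IsReduced ω) (hprod : cs.wordProd ω = v)
    (hdist : (ω.map cs.simple).Nodup) :
    ∀ ω' : List B, cs.IsReduced ω' → cs.wordProd ω' = v →
      Relation.ReflTransGen cs.CommSwap ω ω' ∧
      (ω.map cs.simple).Perm (ω'.map cs.simple) ∧
      (ω'.map cs.simple).Nodup := by
  intro ω' hred' hprod'
  have hω : ω.Nodup := hdist.of_map _
  have h : cs.wordProd ω = cs.wordProd ω' := hprod.trans hprod'.symm
  have hlen : ω'.length ≤ ω.length := by rw [← hred.eq, ← hred'.eq, h]
  have hperm := (cs.perm_of_nodup_of_wordProd_eq hω hlen h).map cs.simple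
  exact ⟨cs.reflTransGen_commSwap_of_nodup hω hlen h, hperm, hperm.nodup_iff.1 hdist⟩
end
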